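/- Let σ₁, σ₂ : (0,∞) → ℂ be continuous, and define the 4×4 complex matrix valued measure μ(Υ) = ∫₀^∞ ∫ χ_Υ(p) (p̸ + m·I₄) Ω_m(dp) σ₁(m) dm + ∫₀^∞ ∫ χ_Υ(p) (p̸ − m·I₄) Ω_m(dp) σ₂(m) dm for bounded Borel Υ ⊆ ℝ⁴. For 0 < a < b and ε > 0 let Υ(a,b,ε) = { p ∈ ℝ⁴ : p⁰ > 0, a² < (p⁰)² − |p⃗|² < b², |p⃗| < ε }. Then lim_{ε→0⁺} ε^{-3} μ(Υ(a,b,ε)) = (4π/3) ∫_a^b [ (γ⁰ + I₄) σ₁(m) + (γ⁰ − I₄) σ₂(m) ] dm (entrywise limit of matrices). -/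

import Mathlib

open Matrix MeasureTheory Complex Filter Topology

/-- The Dirac-representation gamma matrices `γ⁰, γ¹, γ², γ³`. -/
noncomputable def gammaM : Fin 4 → Matrix (Fin 4) (Fin 4) ℂ :=
  ![!![1, 0, 0, 0; 0, 1, 0, 0; 0, 0, -1, 0; 0, 0, 0, -1],
    !![0, 0, 0, 1; 0, 0, 1, 0; 0, -1, 0, 0; -1, 0, 0, 0],
    !![0, 0, 0, -I; 0, 0, I, 0; 0, I, 0, 0; -I, 0, 0, 0],
    !![0, 0, 1, 0; 0, 0, 0, -1; -1, 0, 0, 0; 0, 1, 0, 0]]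

/-- The Feynman slash `p̸ = p⁰γ⁰ − p¹γ¹ − p²γ² − p³γ³`. -/
noncomputable def slash (p : Fin 4 → ℝ) : Matrix (Fin 4) (Fin 4) ℂ :=
  (p 0 : ℂ) • gammaM 0 - (p 1 : ℂ) • gammaM 1 - (p 2 : ℂ) • gammaM 2 - (p 3 : ℂ) • gammaM 3

/-- `ω_m(p) = √(m² + |p|²)`. -/
noncomputable def omegaE (m : ℝ) (p : Fin 3 → ℝ) : ℝ := Real.sqrt (m ^ 2 + ∑ i, (p i) ^ 2)

/-- The standard Lorentz invariant measure `Ω_m` on the forward mass-`m` hyperboloid. -/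
noncomputable def OmegaMeas (m : ℝ) : Measure (Fin 4 → ℝ) :=
  Measure.map (fun p : Fin 3 → ℝ => Fin.cons (omegaE m p) p)
    (((volume : Measure (Fin 3 → ℝ)).restrict {p | m ≠ 0 ∨ p ≠ 0}).withDensity
      fun p => ENNReal.ofReal (omegaE m p)⁻¹)

/-- The `K` invariant matrix valued measure
`μ(Υ) = ∫₀^∞ ∫ χ_Υ(p)(p̸ + m) Ω_m(dp) σ₁(m) dm + ∫₀^∞ ∫ χ_Υ(p)(p̸ − m) Ω_m(dp) σ₂(m) dm`. -/
noncomputable def muMeas (σ₁ σ₂ : ℝ → ℂ) (Υ : Set (Fin 4 → ℝ)) : Matrix (Fin 4) (Fin 4) ℂ :=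
  Matrix.of fun i j =>
    (∫ m in Set.Ioi (0 : ℝ),
      (∫ p, Set.indicator Υ (fun _ => (1 : ℂ)) p *
        ((slash p + (m : ℂ) • (1 : Matrix (Fin 4) (Fin 4) ℂ)) i j) ∂(OmegaMeas m)) * σ₁ m) +
    (∫ m in Set.Ioi (0 : ℝ),
      (∫ p, Set.indicator Υ (fun _ => (1 : ℂ)) p *
        ((slash p - (m : ℂ) • (1 : Matrix (Fin 4) (Fin 4) ℂ)) i j) ∂(OmegaMeas m)) * σ₂ m)

/-- The hyperbolic cylinder `Υ(a,b,ε) = {p : p⁰ > 0, a² < (p⁰)² − |p⃗|² < b², |p⃗| < ε}`. -/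
def hypCyl (a b ε : ℝ) : Set (Fin 4 → ℝ) :=
  {p | 0 < p 0 ∧ a ^ 2 < (p 0) ^ 2 - ∑ i : Fin 3, (p i.succ) ^ 2 ∧
    (p 0) ^ 2 - ∑ i : Fin 3, (p i.succ) ^ 2 < b ^ 2 ∧
    Real.sqrt (∑ i : Fin 3, (p i.succ) ^ 2) < ε}

lemma continuous_omegaE : Continuous fun x : ℝ × (Fin 3 → ℝ) => omegaE x.1 x.2 := by
  unfold omegaE
  fun_prop

lemma omegaE_sq (m : ℝ) (p : Fin 3 → ℝ) : omegaE m p ^ 2 = m ^ 2 + ∑ i, p i ^ 2 :=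
  Real.sq_sqrt (by positivity)

lemma omegaE_nonneg (m : ℝ) (p : Fin 3 → ℝ) : 0 ≤ omegaE m p := Real.sqrt_nonneg _

lemma omegaE_pos {m : ℝ} (hm : 0 < m) (p : Fin 3 → ℝ) : 0 < omegaE m p :=
  Real.sqrt_pos.2 (by positivity)

lemma abs_le_omegaE_mass (m : ℝ) (p : Fin 3 → ℝ) : |m| ≤ omegaE m p :=
  Real.abs_le_sqrt (le_add_of_nonneg_right (by positivity))

lemma abs_le_omegaE (m : ℝ) (p : Fin 3 → ℝ) (k : Fin 3) : |p k| ≤ omegaE m p := by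
  refine Real.abs_le_sqrt ?_
  have : p k ^ 2 ≤ ∑ i, p i ^ 2 :=
    Finset.single_le_sum (f := fun i => p i ^ 2) (fun i _ => sq_nonneg _) (Finset.mem_univ k)
  nlinarith [sq_nonneg m]

lemma omegaE_zero {m : ℝ} (hm : 0 < m) : omegaE m 0 = m := by
  simp [omegaE, Real.sqrt_sq hm.le]

lemma norm_gammaM_le (k i j : Fin 4) : ‖gammaM k i j‖ ≤ 1 := by
  fin_cases k <;> fin_cases i <;> fin_cases j <;> simp [gammaM]

lemma slash_apply (p : Fin 4 → ℝ) (i j : Fin 4) :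
    slash p i j = p 0 * gammaM 0 i j - p 1 * gammaM 1 i j - p 2 * gammaM 2 i j
      - p 3 * gammaM 3 i j := by
  simp [slash]

/-- The entries of `(p̸ + s m) / p⁰` at the point of the mass-`m` hyperboloid over `p`. -/
noncomputable def shellEntry (s : ℂ) (i j : Fin 4) (m : ℝ) (p : Fin 3 → ℝ) : ℂ :=
  ((omegaE m p)⁻¹ : ℝ) *
    (slash (Fin.cons (omegaE m p) p) + (s * m) • (1 : Matrix (Fin 4) (Fin 4) ℂ)) i j

lemma slash_cons_apply (w : ℝ) (p : Fin 3 → ℝ) (i j : Fin 4) :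
    slash (Fin.cons w p) i j = w * gammaM 0 i j - p 0 * gammaM 1 i j - p 1 * gammaM 2 i j
      - p 2 * gammaM 3 i j :=
  slash_apply _ i j

lemma norm_shellEntry_le (s : ℂ) (i j : Fin 4) {m : ℝ} (hm : 0 < m) (p : Fin 3 → ℝ) :
    ‖shellEntry s i j m p‖ ≤ 4 + ‖s‖ := by
  have hw := omegaE_pos hm p
  have hterm : ∀ (x : ℝ) (k : Fin 4), |x| ≤ omegaE m p → ‖(x : ℂ) * gammaM k i j‖ ≤ omegaE m p := by
    intro x k hx
    rw [norm_mul, Complex.norm_real, Real.norm_eq_abs]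
    calc |x| * ‖gammaM k i j‖ ≤ |x| * 1 := by gcongr; exact norm_gammaM_le k i j
      _ ≤ _ := by simpa using hx
  have hone : ‖(1 : Matrix (Fin 4) (Fin 4) ℂ) i j‖ ≤ 1 := by
    rw [Matrix.one_apply]; split_ifs <;> simp
  have hmass : ‖s * (m : ℂ) * (1 : Matrix (Fin 4) (Fin 4) ℂ) i j‖ ≤ ‖s‖ * omegaE m p := by
    rw [norm_mul, norm_mul, Complex.norm_real, Real.norm_eq_abs]
    calc ‖s‖ * |m| * ‖(1 : Matrix (Fin 4) (Fin 4) ℂ) i j‖ ≤ ‖s‖ * omegaE m p * 1 := by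
          gcongr
          exact abs_le_omegaE_mass m p
      _ = _ := mul_one _
  have h0 := hterm (omegaE m p) 0 (abs_of_pos hw).le
  have h1 := hterm (p 0) 1 (abs_le_omegaE m p 0)
  have h2 := hterm (p 1) 2 (abs_le_omegaE m p 1)
  have h3 := hterm (p 2) 3 (abs_le_omegaE m p 2)
  rw [shellEntry, norm_mul, Complex.norm_real, Real.norm_eq_abs, abs_of_pos (inv_pos.2 hw),
    inv_mul_le_iff₀ hw, Matrix.add_apply, slash_cons_apply, Matrix.smul_apply, smul_eq_mul]
  refine (norm_add_le _ _).trans ?_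
  have h := norm_sub_le ((omegaE m p : ℂ) * gammaM 0 i j - p 0 * gammaM 1 i j - p 1 * gammaM 2 i j)
    (p 2 * gammaM 3 i j)
  have h' := norm_sub_le ((omegaE m p : ℂ) * gammaM 0 i j - p 0 * gammaM 1 i j) (p 1 * gammaM 2 i j)
  have h'' := norm_sub_le ((omegaE m p : ℂ) * gammaM 0 i j) (p 0 * gammaM 1 i j)
  linarith

lemma shellEntry_zero (s : ℂ) (i j : Fin 4) {m : ℝ} (hm : 0 < m) :
    shellEntry s i j m 0 = (gammaM 0 + s • (1 : Matrix (Fin 4) (Fin 4) ℂ)) i j := by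
  have hm' : (m : ℂ) ≠ 0 := by exact_mod_cast hm.ne'
  rw [shellEntry, Matrix.add_apply, slash_cons_apply, omegaE_zero hm]
  simp only [Matrix.add_apply, Matrix.smul_apply, smul_eq_mul, Pi.zero_apply]
  push_cast
  field_simp
  ring

lemma measurable_shellEntry (s : ℂ) (i j : Fin 4) :
    Measurable fun x : ℝ × (Fin 3 → ℝ) => shellEntry s i j x.1 x.2 := by
  have := continuous_omegaE.measurable
  simp only [shellEntry, Matrix.add_apply, slash_cons_apply, Matrix.smul_apply, smul_eq_mul]
  fun_prop

lemma continuous_shellEntry (s : ℂ) (i j : Fin 4) {m : ℝ} (hm : 0 < m) :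
    Continuous (shellEntry s i j m) := by
  have h : Continuous (omegaE m) := continuous_omegaE.comp (Continuous.prodMk_right m)
  have h' : Continuous fun p => (omegaE m p)⁻¹ := h.inv₀ fun p => (omegaE_pos hm p).ne'
  unfold shellEntry
  simp only [Matrix.add_apply, slash_cons_apply, Matrix.smul_apply, smul_eq_mul]
  fun_prop

lemma measurableSet_hypCyl (a b ε : ℝ) : MeasurableSet (hypCyl a b ε) := by
  have hq : Measurable fun p : Fin 4 → ℝ => ∑ i : Fin 3, p i.succ ^ 2 := by fun_prop
  have h0 : Measurable fun p : Fin 4 → ℝ => p 0 := by fun_prop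
  have hd := (h0.pow_const 2).sub hq
  exact (measurableSet_lt measurable_const h0).inter ((measurableSet_lt measurable_const hd).inter
    ((measurableSet_lt hd measurable_const).inter (measurableSet_lt hq.sqrt measurable_const)))

lemma integral_OmegaMeas {m : ℝ} (hm : 0 < m) {f : (Fin 4 → ℝ) → ℂ} (hf : Measurable f) :
    ∫ p, f p ∂(OmegaMeas m) =
      ∫ p : Fin 3 → ℝ, ((omegaE m p)⁻¹ : ℝ) * f (Fin.cons (omegaE m p) p) := by
  have hw : Measurable (omegaE m) := (continuous_omegaE.comp (Continuous.prodMk_right m)).measurable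
  have hcons : Measurable fun p : Fin 3 → ℝ => (Fin.cons (omegaE m p) p : Fin 4 → ℝ) := by
    refine measurable_pi_iff.2 fun k => ?_
    refine Fin.cases ?_ (fun k => ?_) k
    · simpa using hw
    · simpa using measurable_pi_apply k
  have huniv : {p : Fin 3 → ℝ | m ≠ 0 ∨ p ≠ 0} = Set.univ := by
    ext p; simp [hm.ne']
  rw [OmegaMeas, integral_map hcons.aemeasurable hf.aestronglyMeasurable, huniv,
    Measure.restrict_univ, integral_withDensity_eq_integral_toReal_smul (by fun_prop) (by simp)]
  refine integral_congr_ae (Eventually.of_forall fun p => ?_)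
  simp [ENNReal.toReal_ofReal (inv_nonneg.2 (omegaE_nonneg m p))]

/-- The open Euclidean unit ball of `Fin 3 → ℝ`. -/
def euclBall : Set (Fin 3 → ℝ) := {q | Real.sqrt (∑ i, q i ^ 2) < 1}

lemma measurableSet_euclBall : MeasurableSet euclBall :=
  measurableSet_lt (by fun_prop) (by fun_prop)

lemma volume_euclBall : volume euclBall = ENNReal.ofReal (4 * Real.pi / 3) := by
  have hball : @WithLp.ofLp 2 (Fin 3 → ℝ) ⁻¹' euclBall
      = Metric.ball (0 : EuclideanSpace ℝ (Fin 3)) 1 := by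
    ext q
    simp [euclBall, EuclideanSpace.norm_eq]
  rw [← (PiLp.volume_preserving_ofLp (Fin 3)).measure_preimage
    measurableSet_euclBall.nullMeasurableSet, hball, EuclideanSpace.volume_ball_fin_three]
  simp [mul_comm]

lemma cons_smul_mem_hypCyl_iff {a b ε m : ℝ} (ha : 0 < a) (hab : a < b) (hε : 0 < ε) (hm : 0 < m)
    (q : Fin 3 → ℝ) :
    (Fin.cons (omegaE m (ε • q)) (ε • q) : Fin 4 → ℝ) ∈ hypCyl a b ε ↔
      m ∈ Set.Ioo a b ∧ q ∈ euclBall := by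
  have hs : Real.sqrt (∑ i, (ε • q) i ^ 2) = ε * Real.sqrt (∑ i, q i ^ 2) := by
    simp only [Pi.smul_apply, smul_eq_mul, mul_pow, ← Finset.mul_sum]
    rw [Real.sqrt_mul (sq_nonneg ε), Real.sqrt_sq hε.le]
  simp only [hypCyl, euclBall, Set.mem_ofPred_eq, Fin.cons_zero, Fin.cons_succ, omegaE_sq,
    add_sub_cancel_right, hs, omegaE_pos hm, true_and, Set.mem_Ioo, and_assoc]
  rw [sq_lt_sq₀ ha.le hm.le, sq_lt_sq₀ hm.le (ha.trans hab).le, mul_lt_iff_lt_one_right hε]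

lemma integral_hypCyl_OmegaMeas (s : ℂ) (i j : Fin 4) {a b ε m : ℝ} (ha : 0 < a) (hab : a < b)
    (hε : 0 < ε) (hm : 0 < m) :
    ((ε : ℂ) ^ 3)⁻¹ * ∫ p, Set.indicator (hypCyl a b ε) (fun _ => (1 : ℂ)) p *
        ((slash p + (s * m : ℂ) • (1 : Matrix (Fin 4) (Fin 4) ℂ)) i j) ∂(OmegaMeas m) =
      Set.indicator (Set.Ioo a b) (fun m => ∫ q in euclBall, shellEntry s i j m (ε • q)) m := by
  have hmeas : Measurable fun p => Set.indicator (hypCyl a b ε) (fun _ => (1 : ℂ)) p *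
        ((slash p + (s * m : ℂ) • (1 : Matrix (Fin 4) (Fin 4) ℂ)) i j) := by
    refine (measurable_const.indicator (measurableSet_hypCyl a b ε)).mul ?_
    simp only [Matrix.add_apply, slash_apply]
    fun_prop
  rw [integral_OmegaMeas hm hmeas]
  have hscale := Measure.integral_comp_smul_of_nonneg (volume : Measure (Fin 3 → ℝ))
    (fun p => (((omegaE m p)⁻¹ : ℝ) : ℂ) *
      (Set.indicator (hypCyl a b ε) (fun _ => (1 : ℂ)) (Fin.cons (omegaE m p) p) *
        ((slash (Fin.cons (omegaE m p) p) +
          (s * m : ℂ) • (1 : Matrix (Fin 4) (Fin 4) ℂ)) i j))) ε (hR := hε.le)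
  rw [Module.finrank_fintype_fun_eq_card, Fintype.card_fin, Complex.real_smul] at hscale
  push_cast at hscale ⊢
  rw [← hscale, Set.indicator_apply, ← integral_indicator measurableSet_euclBall]
  by_cases hmab : m ∈ Set.Ioo a b
  · rw [if_pos hmab]
    refine integral_congr_ae (Eventually.of_forall fun q => ?_)
    by_cases hq : q ∈ euclBall
    · have := (cons_smul_mem_hypCyl_iff ha hab hε hm q).2 ⟨hmab, hq⟩
      simp [this, hq, shellEntry]
    · have : ¬ _ := fun h => hq ((cons_smul_mem_hypCyl_iff ha hab hε hm q).1 h).2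
      simp [this, hq]
  · rw [if_neg hmab, ← integral_zero (Fin 3 → ℝ) ℂ]
    refine integral_congr_ae (Eventually.of_forall fun q => ?_)
    have : ¬ _ := fun h => hmab ((cons_smul_mem_hypCyl_iff ha hab hε hm q).1 h).1
    simp [this]

lemma tendsto_setIntegral_shellEntry (s : ℂ) (i j : Fin 4) {m : ℝ} (hm : 0 < m) :
    Tendsto (fun ε : ℝ => ∫ q in euclBall, shellEntry s i j m (ε • q)) (𝓝[>] 0)
      (𝓝 ((4 * Real.pi / 3 : ℂ) * (gammaM 0 + s • (1 : Matrix (Fin 4) (Fin 4) ℂ)) i j)) := by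
  have hconst : ∫ _q in euclBall, shellEntry s i j m 0 =
      (4 * Real.pi / 3 : ℂ) * (gammaM 0 + s • (1 : Matrix (Fin 4) (Fin 4) ℂ)) i j := by
    rw [setIntegral_const, shellEntry_zero s i j hm, Measure.real, volume_euclBall,
      ENNReal.toReal_ofReal (by positivity), Complex.real_smul]
    push_cast
    rfl
  rw [← hconst]
  have hc := continuous_shellEntry s i j hm
  refine tendsto_integral_filter_of_dominated_convergence (fun _ => 4 + ‖s‖)
    (Eventually.of_forall fun ε => ?_)
    (Eventually.of_forall fun ε => Eventually.of_forall fun q => norm_shellEntry_le s i j hm _)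
    (integrableOn_const (by simp [volume_euclBall])) (Eventually.of_forall fun q => ?_)
  · exact (hc.comp (continuous_const_smul ε)).aestronglyMeasurable
  · have : Tendsto (fun ε : ℝ => ε • q) (𝓝 0) (𝓝 ((0 : ℝ) • q)) :=
      (continuous_id.smul continuous_const).tendsto 0
    rw [zero_smul] at this
    exact ((hc.tendsto 0).comp this).mono_left nhdsWithin_le_nhds

lemma tendsto_hypCyl_integral (s : ℂ) (i j : Fin 4) {σ : ℝ → ℂ} (hσ : ContinuousOn σ (Set.Ioi 0))
    {a b : ℝ} (ha : 0 < a) (hab : a < b) :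
    Tendsto (fun ε : ℝ => ((ε : ℂ) ^ 3)⁻¹ * ∫ m in Set.Ioi (0 : ℝ),
      (∫ p, Set.indicator (hypCyl a b ε) (fun _ => (1 : ℂ)) p *
        ((slash p + (s * m : ℂ) • (1 : Matrix (Fin 4) (Fin 4) ℂ)) i j) ∂(OmegaMeas m)) * σ m)
      (𝓝[>] 0) (𝓝 ((4 * Real.pi / 3 : ℂ) *
        ∫ m in a..b, (gammaM 0 + s • (1 : Matrix (Fin 4) (Fin 4) ℂ)) i j * σ m)) := by
  have hsub : Set.Ioo a b ⊆ Set.Ioi 0 := fun m hm => ha.trans hm.1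
  have hcongr : ∀ ε : ℝ, 0 < ε →
      ∫ m in Set.Ioo a b, (∫ q in euclBall, shellEntry s i j m (ε • q)) * σ m =
      ((ε : ℂ) ^ 3)⁻¹ * ∫ m in Set.Ioi (0 : ℝ),
      (∫ p, Set.indicator (hypCyl a b ε) (fun _ => (1 : ℂ)) p *
        ((slash p + (s * m : ℂ) • (1 : Matrix (Fin 4) (Fin 4) ℂ)) i j) ∂(OmegaMeas m)) * σ m := by
    intro ε hε
    rw [← integral_const_mul, ← Set.inter_eq_right.2 hsub, ← setIntegral_indicator measurableSet_Ioo]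
    refine setIntegral_congr_fun measurableSet_Ioi fun m hm => ?_
    rw [← mul_assoc, integral_hypCyl_OmegaMeas s i j ha hab hε hm, Set.indicator_mul_left]
  refine Tendsto.congr' (eventually_mem_nhdsWithin.mono fun ε hε => hcongr ε hε) ?_
  rw [intervalIntegral.integral_of_le hab.le, integral_Ioc_eq_integral_Ioo, ← integral_const_mul]
  have hint : IntegrableOn σ (Set.Ioo a b) :=
    ((hσ.mono fun m hm => ha.trans_le hm.1).integrableOn_Icc).mono_set Set.Ioo_subset_Icc_self
  refine tendsto_integral_filter_of_dominated_convergence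
    (fun m => (4 + ‖s‖) * (4 * Real.pi / 3) * ‖σ m‖)
    (Eventually.of_forall fun ε => ?_) (Eventually.of_forall fun ε => ?_)
    (hint.norm.const_mul _) ?_
  · refine AEStronglyMeasurable.mul ?_ hint.aestronglyMeasurable
    have : Measurable fun x : ℝ × (Fin 3 → ℝ) => shellEntry s i j x.1 (ε • x.2) :=
      (measurable_shellEntry s i j).comp (by fun_prop : Measurable fun x : ℝ × (Fin 3 → ℝ) =>
        (x.1, ε • x.2))
    exact (this.stronglyMeasurable.integral_prod_right
      (ν := volume.restrict euclBall)).aestronglyMeasurable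
  · refine (ae_restrict_mem measurableSet_Ioo).mono fun m hm => ?_
    rw [norm_mul]
    gcongr
    have := norm_setIntegral_le_of_norm_le_const (μ := volume) (s := euclBall)
      (f := fun q => shellEntry s i j m (ε • q)) (by simp [volume_euclBall])
      fun q _ => norm_shellEntry_le s i j (hsub hm) _
    rwa [Measure.real, volume_euclBall, ENNReal.toReal_ofReal (by positivity)] at this
  · refine (ae_restrict_mem measurableSet_Ioo).mono fun m hm => ?_
    rw [← mul_assoc]
    exact (tendsto_setIntegral_shellEntry s i j (hsub hm)).mul_const _

/-- Spectral calculus limit for `K` invariant matrix valued measures: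
`lim_{ε→0⁺} ε⁻³ μ(Υ(a,b,ε)) = (4π/3) ∫_a^b ((γ⁰+I₄)σ₁(m) + (γ⁰−I₄)σ₂(m)) dm`. -/
theorem stmt12 (σ₁ σ₂ : ℝ → ℂ) (hσ₁ : ContinuousOn σ₁ (Set.Ioi 0))
    (hσ₂ : ContinuousOn σ₂ (Set.Ioi 0)) (a b : ℝ) (ha : 0 < a) (hab : a < b) :
    Tendsto (fun ε : ℝ => ((ε : ℂ) ^ 3)⁻¹ • muMeas σ₁ σ₂ (hypCyl a b ε)) (𝓝[>] 0)
      (𝓝 ((4 * Real.pi / 3 : ℂ) • (Matrix.of fun i j =>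
        ∫ m in a..b, ((gammaM 0 + 1) i j * σ₁ m + (gammaM 0 - 1) i j * σ₂ m)))) := by
  refine tendsto_pi_nhds.2 fun i => tendsto_pi_nhds.2 fun j => ?_
  have h₁ := tendsto_hypCyl_integral 1 i j hσ₁ ha hab
  have h₂ := tendsto_hypCyl_integral (-1) i j hσ₂ ha hab
  have hint : ∀ {σ : ℝ → ℂ} (c : ℂ), ContinuousOn σ (Set.Ioi 0) →
      IntervalIntegrable (fun m => c * σ m) volume a b := by
    intro σ c hσ
    refine (ContinuousOn.intervalIntegrable (hσ.mono fun m hm => ?_)).const_mul c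
    rw [Set.uIcc_of_le hab.le] at hm
    exact ha.trans_le hm.1
  have h := h₁.add h₂
  simp only [one_mul, one_smul, neg_one_mul, neg_smul, ← sub_eq_add_neg, ← mul_add] at h
  rw [← intervalIntegral.integral_add (hint _ hσ₁) (hint _ hσ₂)] at h
  exact h
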